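/- arXiv:1105.1023 — 4 statements merged into one kernel-verified Lean document; each statement's English description precedes it below -/
import Mathlib

section
/- There exists a planar graph G with facial Thue chromatic number exactly 5; in particular, the 5-wheel (a 5-cycle together with a central vertex adjacent to all five cycle vertices) satisfies π_f(G) = 5. -/
/-- A list `l` is a repetition if it is some nonempty block repeated twice. -/
def IsRepetition {α : Type*} (l : List α) : Prop :=
  ∃ w : List α, w ≠ [] ∧ l = w ++ w

/-- A list is nonrepetitive if no nonempty block of consecutive terms forms a repetition. -/
def NonrepetitiveList {α : Type*} (l : List α) : Prop :=
  ∀ w : List α, w ≠ [] → ¬ (w ++ w) <:+: l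

/-- The consecutive pairs of a list read cyclically; a list `w` represents the closed
walk whose steps are exactly `cyclicPairs w`. -/
def cyclicPairs {V : Type*} (w : List V) : List (V × V) := w.zip (w.rotate 1)

/-- A plane graph: a finite simple graph together with a fixed embedding in the plane,
described combinatorially.  Every face is recorded by the collection of its boundary
closed walks (a face of a disconnected plane graph may be bounded by several closed
walks), one face is designated as the outer face, every edge occurs exactly twice on
face boundaries, and Euler's formula `V - E + F = 1 + C` (where `C` is the number of
connected components) holds, which characterizes embeddings in the plane. -/
structure PlaneGraph (V : Type) [Fintype V] [DecidableEq V] where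
  graph : SimpleGraph V
  faces : Multiset (Multiset (List V))
  outer : Multiset (List V)
  outer_mem : outer ∈ faces
  walk_ne : ∀ F ∈ faces, ∀ w ∈ F, w ≠ []
  walk_adj : ∀ F ∈ faces, ∀ w ∈ F, 2 ≤ w.length → ∀ p ∈ cyclicPairs w, graph.Adj p.1 p.2
  edge_twice : ∀ e ∈ graph.edgeSet,
    Multiset.count e
      (Multiset.sum (faces.map (fun F =>
        Multiset.sum (F.map (fun w =>
          (((cyclicPairs w).map (fun p => s(p.1, p.2)) : List (Sym2 V)) : Multiset (Sym2 V))))))) = 2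
  euler : Fintype.card V + Multiset.card faces
      = (graph.edgeSet).ncard + 1 + Nat.card graph.ConnectedComponent

variable {V : Type} [Fintype V] [DecidableEq V]

/-- The vertices incident with the outer face of a plane graph. -/
def PlaneGraph.boundaryVerts (P : PlaneGraph V) : Set V :=
  {v | ∃ w ∈ P.outer, v ∈ w}

/-- A facial path of a plane graph: a (vertex-)path consisting of consecutive vertices
on the boundary of a face. -/
def PlaneGraph.IsFacialPath (P : PlaneGraph V) (p : List V) : Prop :=
  p ≠ [] ∧ p.Nodup ∧ ∃ F ∈ P.faces, ∃ w ∈ F, p <:+: (w ++ w)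

/-- A facial nonrepetitive vertex coloring: the sequence of colors along any facial
path is nonrepetitive. -/
def PlaneGraph.FacialNonrepColoring {α : Type*} (P : PlaneGraph V) (c : V → α) : Prop :=
  ∀ p : List V, P.IsFacialPath p → NonrepetitiveList (p.map c)

/-- The facial Thue chromatic number: the minimum number of colors of a facial
nonrepetitive vertex coloring. -/
noncomputable def PlaneGraph.facialThue (P : PlaneGraph V) : ℕ :=
  sInf {n : ℕ | ∃ c : V → Fin n, P.FacialNonrepColoring c}

/-- The 5-wheel: a 5-cycle on the vertices `0,…,4` together with the central vertex
`5` adjacent to all five cycle vertices. -/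
def wheel5 : SimpleGraph (Fin 6) :=
  SimpleGraph.fromRel (fun i j =>
    (j : ℕ) = 5 ∨ ((i : ℕ) < 5 ∧ (j : ℕ) < 5 ∧ (j : ℕ) = ((i : ℕ) + 1) % 5))

theorem forall_infix_iff {α : Type*} {l : List α} {Q : List α → Prop} :
    (∀ s, s <:+: l → Q s) ↔ ∀ t ∈ l.tails, ∀ s ∈ t.inits, Q s := by
  simp only [List.mem_tails, List.mem_inits, List.infix_iff_prefix_suffix]
  exact ⟨fun h t ht s hs => h s ⟨t, hs, ht⟩, fun h s ⟨t, hs, ht⟩ => h t ht s hs⟩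

theorem nonrepetitiveList_iff {α : Type*} {l : List α} :
    NonrepetitiveList l ↔ ∀ t ∈ l.tails, ∀ s ∈ t.inits, s ≠ [] →
      s ≠ s.take (s.length / 2) ++ s.take (s.length / 2) := by
  rw [← forall_infix_iff (Q := fun s => s ≠ [] →
      s ≠ s.take (s.length / 2) ++ s.take (s.length / 2))]
  constructor
  · intro h s hs hne heq
    refine h (s.take (s.length / 2)) (fun h0 => hne ?_) (heq ▸ hs)
    rw [heq, h0, List.append_nil]
  · intro h w hw hs
    refine h _ hs (by simpa using hw) ?_
    have : (w ++ w).length / 2 = w.length := by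
      rw [List.length_append]
      omega
    rw [this, List.take_left]

instance {α : Type*} [DecidableEq α] (l : List α) : Decidable (NonrepetitiveList l) :=
  decidable_of_iff' _ nonrepetitiveList_iff

theorem PlaneGraph.facialNonrepColoring_iff
    {α : Type*} {P : PlaneGraph V} {c : V → α} :
    P.FacialNonrepColoring c ↔ ∀ F ∈ P.faces, ∀ w ∈ F, ∀ t ∈ (w ++ w).tails, ∀ p ∈ t.inits,
      p ≠ [] → p.Nodup → NonrepetitiveList (p.map c) := by
  simp only [← forall_infix_iff (Q := fun p => p ≠ [] → p.Nodup → NonrepetitiveList (p.map c))]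
  exact ⟨fun h F hF w hw p hp hne hnd => h p ⟨hne, hnd, F, hF, w, hw, hp⟩,
    fun h p ⟨hne, hnd, F, hF, w, hw, hp⟩ => h F hF w hw p hp hne hnd⟩

instance : DecidableRel wheel5.Adj := fun i j =>
  inferInstanceAs (Decidable (i ≠ j ∧ (_ ∨ _)))

theorem wheel5_connected : wheel5.Connected := by
  have hub : ∀ v, wheel5.Reachable v 5 := fun v => by
    by_cases h : v = 5
    · rw [h]
    · exact SimpleGraph.Adj.reachable ⟨h, Or.inl (Or.inl rfl)⟩
  exact ⟨fun u v => (hub u).trans (hub v).symm⟩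

/-- The standard plane embedding of the 5-wheel, whose outer face is bounded by the rim. -/
def wheel5Plane : PlaneGraph (Fin 6) where
  graph := wheel5
  faces := {{[0, 1, 2, 3, 4]}, {[5, 0, 1]}, {[5, 1, 2]}, {[5, 2, 3]}, {[5, 3, 4]}, {[5, 4, 0]}}
  outer := {[0, 1, 2, 3, 4]}
  outer_mem := by simp
  walk_ne := by simp
  walk_adj := by decide
  edge_twice := by
    intro e
    induction e with
    | _ i j =>
      rw [SimpleGraph.mem_edgeSet]
      revert i j
      decide
  euler := by
    have hc : Nat.card wheel5.ConnectedComponent = 1 := by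
      have := wheel5_connected.preconnected.subsingleton_connectedComponent
      have : Nonempty wheel5.ConnectedComponent := ⟨wheel5.connectedComponentMk 0⟩
      exact Nat.card_unique
    have he : wheel5.edgeSet.ncard = 10 := by
      rw [← SimpleGraph.coe_edgeFinset, Set.ncard_coe_finset]
      decide
    rw [hc, he]
    rfl

theorem wheel5Plane_coloring_five :
    wheel5Plane.FacialNonrepColoring (![0, 1, 2, 0, 3, 4] : Fin 6 → Fin 5) := by
  rw [PlaneGraph.facialNonrepColoring_iff]
  simp only [wheel5Plane, Multiset.insert_eq_cons, Multiset.forall_mem_cons,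
    Multiset.mem_singleton, forall_eq]
  decide

/-- In a facial nonrepetitive coloring of a plane graph, no facial path reads `xyxy`. -/
theorem PlaneGraph.FacialNonrepColoring.not_square
    {α : Type*} {P : PlaneGraph V} {c : V → α} (h : P.FacialNonrepColoring c) {u v x y : V}
    (hp : P.IsFacialPath [u, v, x, y]) : ¬ (c u = c x ∧ c v = c y) := fun ⟨h₁, h₂⟩ =>
  h _ hp [c u, c v] (by simp) (by simp [h₁, h₂])

/-- In a facial nonrepetitive coloring, the ends of a facial edge have distinct colors. -/
theorem PlaneGraph.FacialNonrepColoring.ne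
    {α : Type*} {P : PlaneGraph V} {c : V → α} (h : P.FacialNonrepColoring c) {u v : V}
    (hp : P.IsFacialPath [u, v]) : c u ≠ c v := fun h₁ =>
  h _ hp [c u] (by simp) (by simp [h₁])

theorem wheel5Plane_isFacialPath_iff {p : List (Fin 6)} :
    wheel5Plane.IsFacialPath p ↔ p ≠ [] ∧ p.Nodup ∧
      ∃ w ∈ [[0, 1, 2, 3, 4], [5, 0, 1], [5, 1, 2], [5, 2, 3], [5, 3, 4], [5, 4, 0]],
        p <:+: w ++ w := by
  simp [PlaneGraph.IsFacialPath, wheel5Plane]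

instance : DecidablePred wheel5Plane.IsFacialPath := fun _ =>
  decidable_of_iff' _ wheel5Plane_isFacialPath_iff

set_option synthInstance.maxSize 2000 in
/-- No four colors `f` (hub) and `a`, `b`, `c`, `d`, `e` (rim) give a facial nonrepetitive
coloring of the 5-wheel. -/
theorem no_wheel5_coloring_four : ∀ f a : Fin 4, f ≠ a → ∀ b, f ≠ b → a ≠ b →
    ∀ c, f ≠ c → b ≠ c → ∀ d, f ≠ d → c ≠ d → ¬ (a = c ∧ b = d) →
    ∀ e, f ≠ e → d ≠ e → e ≠ a → ¬ (b = d ∧ c = e) → ¬ (c = e ∧ d = a) →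
      ¬ (d = a ∧ e = b) → ¬ (e = b ∧ a = c) → False := by
  decide

theorem not_wheel5Plane_coloring_four (c : Fin 6 → Fin 4) :
    ¬ wheel5Plane.FacialNonrepColoring c := fun h =>
  no_wheel5_coloring_four (c 5) (c 0) (h.ne (by decide)) (c 1) (h.ne (by decide))
    (h.ne (by decide)) (c 2) (h.ne (by decide)) (h.ne (by decide)) (c 3) (h.ne (by decide))
    (h.ne (by decide)) (h.not_square (by decide)) (c 4) (h.ne (by decide)) (h.ne (by decide))
    (h.ne (by decide)) (h.not_square (by decide)) (h.not_square (by decide))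
    (h.not_square (by decide)) (h.not_square (by decide))

theorem PlaneGraph.FacialNonrepColoring.comp_injective
    {α β : Type*} {P : PlaneGraph V} {c : V → α} (h : P.FacialNonrepColoring c) {g : α → β}
    (hg : g.Injective) : P.FacialNonrepColoring (g ∘ c) := by
  intro p hp w hw hs
  rw [← List.map_map, List.infix_map_iff] at hs
  obtain ⟨s, hs, heq⟩ := hs
  obtain ⟨s₁, s₂, rfl, h₁, h₂⟩ := List.map_eq_append_iff.mp heq.symm
  obtain rfl : s₁ = s₂ := hg.list_map (h₁.trans h₂.symm)
  exact h p hp s₁ (by rintro rfl; exact hw h₁.symm) hs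

/-- There exists a planar graph `G` with facial Thue chromatic number exactly `5`;
in particular, the 5-wheel is such a graph. -/
theorem exists_planar_facialThue_eq_five :
    ∃ P : PlaneGraph (Fin 6), P.graph = wheel5 ∧ P.facialThue = 5 := by
  refine ⟨wheel5Plane, rfl, le_antisymm (Nat.sInf_le ⟨_, wheel5Plane_coloring_five⟩) ?_⟩
  refine le_csInf ⟨5, _, wheel5Plane_coloring_five⟩ ?_
  rintro n ⟨c, hc⟩
  by_contra! hn
  exact not_wheel5Plane_coloring_four _
    (hc.comp_injective (Fin.castLE_injective (Nat.le_of_lt_succ hn)))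
end

section
/- Every nonrepetitive vertex coloring of the cycle C_5 on five vertices uses at least 4 colors. -/
/-- A vertex coloring `c` of a graph `G` is nonrepetitive if there is no path
`v₁, …, v_{2t}` in `G` such that `v_i` and `v_{t+i}` receive the same color for all
`i = 1, …, t`; equivalently, the color sequence along any path is not a repetition. -/
def NonrepColoring {V : Type*} {α : Type*} (G : SimpleGraph V) (c : V → α) : Prop :=
  ∀ (u v : V) (p : G.Walk u v), p.IsPath → ¬ IsRepetition (p.support.map c)

/-- The Thue chromatic number of a graph `G`: the minimum number of colors needed in
a nonrepetitive coloring of `G`. -/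
noncomputable def thueNumber {V : Type*} (G : SimpleGraph V) : ℕ :=
  sInf {n : ℕ | ∃ c : V → Fin n, NonrepColoring G c}

/-- Adjacent vertices receive different colors in a nonrepetitive coloring. -/
theorem NonrepColoring.ne_of_adj {V α : Type*} {G : SimpleGraph V} {c : V → α}
    (hc : NonrepColoring G c) {u v : V} (h : G.Adj u v) : c u ≠ c v := fun huv =>
  hc u v (.cons h .nil) (by simp [h.ne]) ⟨[c u], by simp, by simp [huv]⟩

/-- A path on four vertices is not colored in the pattern `abab`. -/
theorem NonrepColoring.ne_of_path {V α : Type*} {G : SimpleGraph V} {c : V → α}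
    (hc : NonrepColoring G c) {u v w x : V} (huv : G.Adj u v) (hvw : G.Adj v w)
    (hwx : G.Adj w x) (huw : u ≠ w) (hux : u ≠ x) (hvx : v ≠ x) (h : c u = c w) :
    c v ≠ c x := fun h' =>
  hc u x (.cons huv (.cons hvw (.cons hwx .nil)))
    (by simp [huv.ne, hvw.ne, hwx.ne, huw, hux, hvx])
    ⟨[c u, c v], by simp, by simp [h, h']⟩

/-- A nonrepetitive coloring of `C₅` is injective on the complement of some vertex. -/
theorem NonrepColoring.exists_injOn_compl_cycleGraph_five {α : Type*} {c : Fin 5 → α}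
    (hc : NonrepColoring (SimpleGraph.cycleGraph 5) c) :
    ∃ k : Fin 5, Set.InjOn c {k}ᶜ := by
  have adj : ∀ i : Fin 5, (SimpleGraph.cycleGraph 5).Adj i (i + 1) := by decide
  have h₁ : ∀ i, c i ≠ c (i + 1) := fun i => hc.ne_of_adj (adj i)
  have h₂ : ∀ i, c i = c (i + 2) → c (i + 1) ≠ c (i + 3) := fun i =>
    hc.ne_of_path (adj i) (by simpa [add_assoc] using adj (i + 1))
      (by simpa [add_assoc] using adj (i + 2)) (by simp) (by simp) (by simp)
  simp [Fin.forall_fin_succ, Fin.exists_fin_succ, Set.InjOn] at h₁ h₂ ⊢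
  grind

/-- Every nonrepetitive vertex coloring of the cycle `C₅` on five vertices uses at
least `4` colors. -/
theorem nonrep_coloring_C5_four_colors {α : Type*} [DecidableEq α]
    (c : Fin 5 → α) (hc : NonrepColoring (SimpleGraph.cycleGraph 5) c) :
    4 ≤ (Finset.univ.image c).card := by
  obtain ⟨k, hk⟩ := hc.exists_injOn_compl_cycleGraph_five
  calc 4 = (({k}ᶜ : Finset (Fin 5)).image c).card := by
        rw [Finset.card_image_of_injOn (by simpa using hk), Finset.card_compl]
        simp
    _ ≤ _ := Finset.card_le_card (Finset.image_subset_image (Finset.subset_univ _))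
end

section
/- For every k ≥ 0, the string β_{2k} over the alphabet {0,1,2} is a palindrome (it reads the same backwards) and is nonrepetitive (no block of consecutive terms of β_{2k} is a repetition s_1,...,s_j,s_1,...,s_j). -/
/-- The complement of a string over `{0,1,2}`:
`\overline{a₁ a₂ … aₙ} = (2-a₁)(2-a₂)…(2-aₙ)`. -/
def comp3 (l : List ℕ) : List ℕ := l.map (fun a => 2 - a)

/-- Thue's strings over `{0,1,2}`: `β₀ = 2` and, for `i ≥ 1`,
`βᵢ = β_{i-1} · 2 · \overline{β_{i-1}}` if `i` is even and
`βᵢ = β_{i-1} · 1 · \overline{β_{i-1}}` if `i` is odd. -/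
def beta : ℕ → List ℕ
  | 0 => [2]
  | i + 1 =>
      if Even (i + 1) then beta i ++ [2] ++ comp3 (beta i)
      else beta i ++ [1] ++ comp3 (beta i)

/-- The Thue–Morse sequence: the parity of the number of binary digits `1`. -/
def thueMorse (n : ℕ) : ℕ := (Nat.digits 2 n).sum % 2

theorem thueMorse_le_one (n : ℕ) : thueMorse n ≤ 1 := by
  unfold thueMorse; omega

theorem thueMorse_two_mul (n : ℕ) : thueMorse (2 * n) = thueMorse n := by
  unfold thueMorse
  rcases Nat.eq_zero_or_pos n with rfl | hn
  · rfl
  · rw [Nat.digits_def' (by norm_num) (by omega : 0 < 2 * n)]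
    simp

theorem thueMorse_two_mul_add_one (n : ℕ) : thueMorse (2 * n + 1) = 1 - thueMorse n := by
  unfold thueMorse
  rw [Nat.digits_def' (by norm_num) (by omega : 0 < 2 * n + 1),
    show (2 * n + 1) % 2 = 1 by omega, show (2 * n + 1) / 2 = n by omega, List.sum_cons]
  omega

theorem thueMorse_two_pow_add (i : ℕ) :
    ∀ n < 2 ^ i, thueMorse (2 ^ i + n) = 1 - thueMorse n := by
  induction i with
  | zero =>
    intro n hn
    obtain rfl : n = 0 := by simpa using hn
    simp [thueMorse]
  | succ i ih =>
    intro n hn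
    rw [pow_succ] at hn ⊢
    obtain ⟨m, rfl | rfl⟩ := n.even_or_odd'
    · rw [show 2 ^ i * 2 + 2 * m = 2 * (2 ^ i + m) by ring, thueMorse_two_mul,
        thueMorse_two_mul, ih m (by omega)]
    · rw [show 2 ^ i * 2 + (2 * m + 1) = 2 * (2 ^ i + m) + 1 by ring,
        thueMorse_two_mul_add_one, thueMorse_two_mul_add_one, ih m (by omega)]

theorem thueMorse_two_pow_sub_one (i : ℕ) : thueMorse (2 ^ i - 1) = i % 2 := by
  induction i with
  | zero => simp [thueMorse]
  | succ i ih =>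
    have := Nat.two_pow_pos i
    rw [show 2 ^ (i + 1) - 1 = 2 * (2 ^ i - 1) + 1 by rw [pow_succ]; omega,
      thueMorse_two_mul_add_one, ih]
    omega

theorem thueMorse_ne_succ_of_even {n : ℕ} (hn : Even n) :
    thueMorse n ≠ thueMorse (n + 1) := by
  obtain ⟨m, rfl⟩ := hn.two_dvd
  rw [thueMorse_two_mul, thueMorse_two_mul_add_one]
  have := thueMorse_le_one m
  omega

/-- The Thue–Morse sequence is overlap-free. -/
theorem thueMorse_overlap_free (j : ℕ) (hj : 0 < j) (p : ℕ) :
    ¬ ∀ i ≤ j, thueMorse (p + i) = thueMorse (p + i + j) := by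
  induction j using Nat.strong_induction_on generalizing p with
  | _ j ih =>
    intro h
    rcases j.even_or_odd with hje | hjo
    · obtain ⟨m, rfl⟩ := hje.two_dvd
      obtain ⟨q, rfl | rfl⟩ := p.even_or_odd'
      · refine ih m (by omega) (by omega) q fun i hi => ?_
        have := h (2 * i) (by omega)
        rwa [show 2 * q + 2 * i = 2 * (q + i) by ring, ← mul_add, thueMorse_two_mul,
          thueMorse_two_mul] at this
      · refine ih m (by omega) (by omega) q fun i hi => ?_
        have := h (2 * i) (by omega)
        rw [show 2 * q + 1 + 2 * i + 2 * m = 2 * (q + i + m) + 1 by ring,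
          show 2 * q + 1 + 2 * i = 2 * (q + i) + 1 by ring,
          thueMorse_two_mul_add_one, thueMorse_two_mul_add_one] at this
        have := thueMorse_le_one (q + i)
        have := thueMorse_le_one (q + i + m)
        omega
    · have alt : ∀ i < j, thueMorse (p + i) ≠ thueMorse (p + i + 1) := by
        intro i hi
        rcases (p + i).even_or_odd with he | ho
        · exact thueMorse_ne_succ_of_even he
        · have h₀ := h i hi.le
          have h₁ := h (i + 1) hi
          rw [← add_assoc] at h₁
          rw [h₀, h₁, show p + i + 1 + j = p + i + j + 1 by ring]
          exact thueMorse_ne_succ_of_even (ho.add_odd hjo)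
      have parity : ∀ i ≤ j, thueMorse (p + i) % 2 = (thueMorse p + i) % 2 := by
        intro i
        induction i with
        | zero => simp
        | succ i hi =>
          intro hij
          have := hi (by omega)
          have := alt i hij
          have := thueMorse_le_one (p + i)
          have := thueMorse_le_one (p + i + 1)
          rw [← add_assoc]
          omega
      have h₀ := h 0 (by omega)
      have hp := parity j le_rfl
      rw [add_zero] at h₀
      rw [← h₀] at hp
      obtain ⟨r, rfl⟩ := hjo
      omega

/-- The ternary Thue–Morse sequence: shifted differences of the Thue–Morse sequence. -/
def ternaryThueMorse (n : ℕ) : ℕ := 1 + thueMorse (n + 1) - thueMorse n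

/-- The ternary Thue–Morse sequence is square-free. -/
theorem ternaryThueMorse_square_free (j : ℕ) (hj : 0 < j) (p : ℕ) :
    ¬ ∀ i < j, ternaryThueMorse (p + i) = ternaryThueMorse (p + i + j) := by
  intro h
  have key : ∀ i ≤ j,
      thueMorse (p + i) + thueMorse (p + j) = thueMorse (p + i + j) + thueMorse p := by
    intro i
    induction i with
    | zero => intro _; simp [add_comm]
    | succ i hi =>
      intro hij
      have h₀ := hi (by omega)
      have h₁ := h i hij
      unfold ternaryThueMorse at h₁
      have := thueMorse_le_one (p + i)
      have := thueMorse_le_one (p + i + j)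
      rw [← add_assoc, show p + i + 1 + j = p + i + j + 1 by ring]
      omega
  refine thueMorse_overlap_free j hj p fun i hi => ?_
  have h₀ := key i hi
  have h₁ := key j le_rfl
  have := thueMorse_le_one (p + j)
  have := thueMorse_le_one p
  have := thueMorse_le_one (p + j + j)
  omega

theorem nonrepetitiveList_map_range_ternaryThueMorse (n : ℕ) :
    NonrepetitiveList ((List.range n).map ternaryThueMorse) := by
  rintro w hw ⟨s, u, h⟩
  refine ternaryThueMorse_square_free w.length (List.length_pos_iff.2 hw) s.length
    fun i hi => ?_
  have hlen := congrArg List.length h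
  simp only [List.length_append, List.length_map, List.length_range] at hlen
  have h₀ := congrArg (fun l => l[s.length + i]?) h
  have h₁ := congrArg (fun l => l[s.length + i + w.length]?) h
  have e₀ : (s ++ (w ++ w) ++ u)[s.length + i]? = w[i]? := by
    rw [List.append_assoc, List.getElem?_append_right (by omega), List.append_assoc,
      List.getElem?_append_left (by omega)]
    congr 1
    omega
  have e₁ : (s ++ (w ++ w) ++ u)[s.length + i + w.length]? = w[i]? := by
    rw [List.append_assoc, List.getElem?_append_right (by omega), List.append_assoc,
      List.getElem?_append_right (by omega), List.getElem?_append_left (by omega)]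
    congr 1
    omega
  simp only [e₀, e₁] at h₀ h₁
  rw [h₀] at h₁
  simpa [List.getElem?_range (show s.length + i < n by omega),
    List.getElem?_range (show s.length + i + w.length < n by omega)] using h₁

theorem beta_eq_map_range (i : ℕ) :
    beta i = (List.range (2 ^ (i + 1) - 1)).map ternaryThueMorse := by
  induction i with
  | zero => simp [beta, ternaryThueMorse, thueMorse]
  | succ i ih =>
    have hpos := Nat.two_pow_pos (i + 1)
    have middle : ternaryThueMorse (2 ^ (i + 1) - 1) = if Even (i + 1) then 2 else 1 := by
      have h₀ := thueMorse_two_pow_add (i + 1) 0 hpos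
      have h₁ := thueMorse_two_pow_sub_one (i + 1)
      rw [ternaryThueMorse, Nat.sub_add_cancel hpos, h₁, ← add_zero (2 ^ (i + 1)), h₀]
      have : thueMorse 0 = 0 := by simp [thueMorse]
      split_ifs with h <;> rw [Nat.even_iff] at h <;> omega
    have last : ∀ n < 2 ^ (i + 1) - 1,
        ternaryThueMorse (2 ^ (i + 1) + n) = 2 - ternaryThueMorse n := by
      intro n hn
      unfold ternaryThueMorse
      rw [add_assoc, thueMorse_two_pow_add _ n (by omega),
        thueMorse_two_pow_add _ (n + 1) (by omega)]
      have := thueMorse_le_one n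
      have := thueMorse_le_one (n + 1)
      omega
    have step : beta (i + 1) =
        beta i ++ [if Even (i + 1) then 2 else 1] ++ comp3 (beta i) := by
      rw [beta]; split_ifs <;> rfl
    rw [step, ← middle, ih,
      show 2 ^ (i + 1 + 1) - 1 = (2 ^ (i + 1) - 1 + 1) + (2 ^ (i + 1) - 1) by
        rw [pow_succ 2 (i + 1)]; omega,
      List.range_add, List.map_append, List.range_succ, List.map_append, comp3]
    congr 1
    rw [List.map_map, List.map_map]
    refine List.map_congr_left fun n hn => ?_
    rw [Function.comp_apply, Function.comp_apply, Nat.sub_add_cancel hpos,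
      last n (List.mem_range.1 hn)]

theorem comp3_comp3_beta (i : ℕ) : comp3 (comp3 (beta i)) = beta i := by
  rw [beta_eq_map_range, comp3, comp3, List.map_map, List.map_map]
  refine List.map_congr_left fun n _ => ?_
  have := thueMorse_le_one (n + 1)
  simp only [Function.comp_apply, ternaryThueMorse]
  omega

theorem reverse_comp3 (l : List ℕ) : (comp3 l).reverse = comp3 l.reverse :=
  List.map_reverse.symm

theorem reverse_beta (i : ℕ) :
    (beta i).reverse = if Even i then beta i else comp3 (beta i) := by
  induction i with
  | zero => simp [beta]
  | succ i ih =>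
    have hc := comp3_comp3_beta i
    by_cases hi : Even i
    · have hi' : ¬ Even (i + 1) := by simpa [Nat.even_add_one] using hi
      rw [if_pos hi] at ih
      rw [if_neg hi', beta, if_neg hi']
      simp only [List.reverse_append, reverse_comp3, ih]
      have happ (l m : List ℕ) : comp3 (l ++ m) = comp3 l ++ comp3 m := List.map_append
      rw [happ, happ, hc]
      simp [comp3]
    · have hi' : Even (i + 1) := by simpa [Nat.even_add_one] using hi
      rw [if_neg hi] at ih
      rw [if_pos hi', beta, if_pos hi']
      simp only [List.reverse_append, reverse_comp3, ih, hc]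
      simp

/-- **Thue.** For every `k ≥ 0`, the string `β_{2k}` is a palindrome and is
nonrepetitive. -/
theorem beta_even_palindromic_nonrepetitive (k : ℕ) :
    (beta (2 * k)).reverse = beta (2 * k) ∧ NonrepetitiveList (beta (2 * k)) := by
  refine ⟨by rw [reverse_beta, if_pos (even_two_mul k)], ?_⟩
  rw [beta_eq_map_range]
  exact nonrepetitiveList_map_range_ternaryThueMorse _
end

section
/- The Thue chromatic number of the path P_n on n vertices satisfies: π(P_1) = 1, π(P_2) = π(P_3) = 2, and π(P_n) = 3 for every n ≥ 4. -/
theorem thueMorse_lt_two (n : ℕ) : thueMorse n < 2 := Nat.mod_lt _ (by norm_num)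

theorem odd_of_thueMorse_eq_succ {x : ℕ} (h : thueMorse x = thueMorse (x + 1)) : x % 2 = 1 := by
  by_contra hx
  obtain ⟨m, rfl⟩ : ∃ m, x = 2 * m := ⟨x / 2, by omega⟩
  rw [thueMorse_two_mul, thueMorse_two_mul_add_one] at h
  have := thueMorse_lt_two m
  omega

/-- The Thue–Morse sequence contains no cube of a letter. -/
theorem thueMorse_not_cube (x : ℕ) (h₁ : thueMorse x = thueMorse (x + 1))
    (h₂ : thueMorse (x + 1) = thueMorse (x + 2)) : False := by
  have := odd_of_thueMorse_eq_succ h₁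
  have := odd_of_thueMorse_eq_succ h₂
  omega

/-- Every window of five consecutive letters contains two equal adjacent letters. -/
theorem exists_thueMorse_eq_succ (a : ℕ) :
    ∃ x, a ≤ x ∧ x ≤ a + 3 ∧ thueMorse x = thueMorse (x + 1) := by
  by_contra! H
  have h₀ := H a (by omega) (by omega)
  have h₁ := H (a + 1) (by omega) (by omega)
  have h₂ := H (a + 2) (by omega) (by omega)
  have h₃ := H (a + 3) (by omega) (by omega)
  have b₀ := thueMorse_lt_two a
  have b₁ := thueMorse_lt_two (a + 1)
  have b₂ := thueMorse_lt_two (a + 2)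
  have b₃ := thueMorse_lt_two (a + 3)
  have b₄ := thueMorse_lt_two (a + 4)
  have e₁ : thueMorse a = thueMorse (a + 2) := by grind
  have e₂ : thueMorse (a + 2) = thueMorse (a + 4) := by grind
  obtain ⟨m, rfl | rfl⟩ : ∃ m, a = 2 * m ∨ a = 2 * m + 1 := ⟨a / 2, by omega⟩
  · rw [show 2 * m + 2 = 2 * (m + 1) by ring, show 2 * m + 4 = 2 * (m + 2) by ring] at *
    simp only [thueMorse_two_mul] at e₁ e₂
    exact thueMorse_not_cube m e₁ e₂
  · rw [show 2 * m + 1 + 2 = 2 * (m + 1) + 1 by ring,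
      show 2 * m + 1 + 4 = 2 * (m + 2) + 1 by ring] at *
    simp only [thueMorse_two_mul_add_one] at e₁ e₂
    have c₀ := thueMorse_lt_two m
    have c₁ := thueMorse_lt_two (m + 1)
    have c₂ := thueMorse_lt_two (m + 2)
    exact thueMorse_not_cube m (by omega) (by omega)

/-- The Thue–Morse sequence is overlap-free. -/
theorem thueMorse_overlapFree (p : ℕ) (hp : 0 < p) (i : ℕ)
    (h : ∀ j ≤ p, thueMorse (i + j) = thueMorse (i + p + j)) : False := by
  induction p using Nat.strong_induction_on generalizing i with
  | _ p ih =>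
    obtain ⟨q, rfl | rfl⟩ : ∃ q, p = 2 * q ∨ p = 2 * q + 1 := ⟨p / 2, by omega⟩
    · obtain ⟨m, rfl | rfl⟩ : ∃ m, i = 2 * m ∨ i = 2 * m + 1 := ⟨i / 2, by omega⟩
      · refine ih q (by omega) (by omega) m fun k hk => ?_
        have := h (2 * k) (by omega)
        rwa [show 2 * m + 2 * k = 2 * (m + k) by ring,
          show 2 * m + 2 * q + 2 * k = 2 * (m + q + k) by ring,
          thueMorse_two_mul, thueMorse_two_mul] at this
      · refine ih q (by omega) (by omega) m fun k hk => ?_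
        have := h (2 * k) (by omega)
        rw [show 2 * m + 1 + 2 * k = 2 * (m + k) + 1 by ring,
          show 2 * m + 1 + 2 * q + 2 * k = 2 * (m + q + k) + 1 by ring,
          thueMorse_two_mul_add_one, thueMorse_two_mul_add_one] at this
        have := thueMorse_lt_two (m + k)
        have := thueMorse_lt_two (m + q + k)
        omega
    · rcases Nat.eq_zero_or_pos q with rfl | hq
      · exact thueMorse_not_cube i (h 0 (by omega)) (h 1 (by omega))
      · obtain ⟨x, hx₁, hx₂, hx⟩ := exists_thueMorse_eq_succ i
        have hodd := odd_of_thueMorse_eq_succ hx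
        by_cases hle : x ≤ i + 2 * q
        · have e₁ := h (x - i) (by omega)
          have e₂ := h (x + 1 - i) (by omega)
          rw [show i + (x - i) = x by omega,
            show i + (2 * q + 1) + (x - i) = x + 2 * q + 1 by omega] at e₁
          rw [show i + (x + 1 - i) = x + 1 by omega,
            show i + (2 * q + 1) + (x + 1 - i) = x + 2 * q + 1 + 1 by omega] at e₂
          have := odd_of_thueMorse_eq_succ (e₁.symm.trans (hx.trans e₂))
          omega
        · obtain ⟨rfl, rfl⟩ : q = 1 ∧ x = i + 3 := by omega
          have e₁ := h 0 (by omega)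
          have e₂ := h 1 (by omega)
          have := odd_of_thueMorse_eq_succ (e₁.trans (hx.trans e₂.symm))
          omega

/-- The shifted difference sequence of the Thue–Morse sequence. -/
def ternaryThue (n : ℕ) : Fin 3 :=
  ⟨thueMorse (n + 1) + 1 - thueMorse n, by have := thueMorse_lt_two (n + 1); omega⟩

theorem ternaryThue_squareFree (i t : ℕ) (ht : 0 < t) :
    ∃ k < t, ternaryThue (i + k) ≠ ternaryThue (i + t + k) := by
  by_contra! H
  have key : ∀ j ≤ t, thueMorse (i + j) + thueMorse (i + t) =
      thueMorse (i + t + j) + thueMorse i := by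
    intro j
    induction j with
    | zero => intro; simp [add_comm]
    | succ j ih =>
      intro hj
      have e := congrArg Fin.val (H j (by omega))
      simp only [ternaryThue] at e
      have := ih (by omega)
      have := thueMorse_lt_two (i + j)
      have := thueMorse_lt_two (i + t + j)
      rw [← add_assoc, ← add_assoc]
      omega
  have h := key t le_rfl
  have := thueMorse_lt_two i
  have := thueMorse_lt_two (i + t)
  have := thueMorse_lt_two (i + t + t)
  refine thueMorse_overlapFree t ht i fun j hj => ?_
  have := key j hj
  omega

/-- An injective finite sequence of naturals with steps `±1` is increasing or decreasing. -/
theorem eq_add_or_eq_sub_of_injOn_of_step (f : ℕ → ℕ) (L : ℕ)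
    (hinj : ∀ a ≤ L, ∀ b ≤ L, f a = f b → a = b)
    (hstep : ∀ k < L, f (k + 1) = f k + 1 ∨ f k = f (k + 1) + 1) :
    (∀ k ≤ L, f k = f 0 + k) ∨ (∀ k ≤ L, f k + k = f 0) := by
  induction L with
  | zero =>
    left; intro k hk
    obtain rfl : k = 0 := by omega
    rfl
  | succ L ih =>
    have hs := hstep L (by omega)
    have hL : 0 < L → f (L + 1) ≠ f (L - 1) := fun hL h => by
      have := hinj _ (by omega) _ (by omega) h
      omega
    rcases Nat.eq_zero_or_pos L with rfl | hpos
    · rcases hs with hs | hs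
      · left; intro k hk
        interval_cases k
        · rfl
        · exact hs
      · right; intro k hk
        interval_cases k
        · rfl
        · exact hs.symm
    · have hne := hL hpos
      rcases ih (fun a ha b hb => hinj a (by omega) b (by omega))
        (fun k hk => hstep k (by omega)) with h | h
      · left; intro k hk
        rcases Nat.lt_or_ge L k with hk' | hk'
        · obtain rfl : k = L + 1 := by omega
          have := h L le_rfl
          have := h (L - 1) (by omega)
          omega
        · exact h k hk'
      · right; intro k hk
        rcases Nat.lt_or_ge L k with hk' | hk'
        · obtain rfl : k = L + 1 := by omega
          have := h L le_rfl
          have := h (L - 1) (by omega)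
          omega
        · exact h k hk'

/-- A sequence without squares in its first `n` terms colors `Pₙ` nonrepetitively. -/
theorem nonrepColoring_pathGraph {α : Type*} (n : ℕ) (s : ℕ → α)
    (hs : ∀ i t, 0 < t → i + 2 * t ≤ n → ∃ k < t, s (i + k) ≠ s (i + t + k)) :
    NonrepColoring (SimpleGraph.pathGraph n) (fun v => s v) := by
  rintro u v p hp ⟨w, hw, hpw⟩
  have ht : 0 < w.length := List.length_pos_iff.mpr hw
  have hlen : p.length + 1 = 2 * w.length := by
    have := congrArg List.length hpw
    simp only [List.length_map, SimpleGraph.Walk.length_support, List.length_append] at this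
    omega
  have hper : ∀ k < w.length, s (p.getVert k) = s (p.getVert (k + w.length)) := by
    have aux : ∀ k ≤ p.length, (w ++ w)[k]? = some (s (p.getVert k)) := by
      intro k hk
      rw [← hpw, List.getElem?_map, ← SimpleGraph.Walk.getVert_eq_support_getElem? p hk]
      rfl
    intro k hk
    have h₁ := aux k (by omega)
    have h₂ := aux (k + w.length) (by omega)
    rw [List.getElem?_append_left hk] at h₁
    rw [List.getElem?_append_right (by omega), Nat.add_sub_cancel, h₁] at h₂
    exact Option.some.inj h₂
  have hmono := eq_add_or_eq_sub_of_injOn_of_step (fun k => (p.getVert k : ℕ)) p.length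
    (fun a ha b hb hab => hp.getVert_injOn ha hb (Fin.ext hab))
    (fun k hk => by
      have := p.adj_getVert_succ hk
      rw [SimpleGraph.pathGraph_adj] at this
      omega)
  have hlt : ∀ k, (p.getVert k : ℕ) < n := fun k => (p.getVert k).isLt
  rcases hmono with h | h
  · have := h p.length le_rfl
    have := hlt p.length
    obtain ⟨k, hk, hne⟩ := hs (p.getVert 0) w.length ht (by omega)
    apply hne
    rw [← h k (by omega), show (p.getVert 0 : ℕ) + w.length + k =
      p.getVert (k + w.length) by rw [h (k + w.length) (by omega)]; omega]
    exact hper k hk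
  · have := h p.length le_rfl
    have := hlt 0
    obtain ⟨k, hk, hne⟩ := hs (p.getVert p.length) w.length ht (by omega)
    apply hne
    have h₁ := h (w.length - 1 - k) (by omega)
    have h₂ := h (w.length - 1 - k + w.length) (by omega)
    rw [show (p.getVert p.length : ℕ) + k = p.getVert (w.length - 1 - k + w.length) by omega,
      show (p.getVert p.length : ℕ) + w.length + k = p.getVert (w.length - 1 - k) by omega]
    exact (hper _ (by omega)).symm

theorem thueNumber_eq {V : Type*} {G : SimpleGraph V} {k : ℕ}
    (h : ∃ c : V → Fin k, NonrepColoring G c)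
    (hk : ∀ m (c : V → Fin m), NonrepColoring G c → k ≤ m) : thueNumber G = k :=
  IsLeast.csInf_eq (s := {n : ℕ | ∃ c : V → Fin n, NonrepColoring G c})
    ⟨h, fun m ⟨c, hc⟩ => hk m c hc⟩

theorem two_le_of_nonrepColoring_pathGraph {n m : ℕ} (hn : 2 ≤ n) (c : Fin n → Fin m)
    (hc : NonrepColoring (SimpleGraph.pathGraph n) c) : 2 ≤ m := by
  have h := hc.ne_of_adj (u := ⟨0, by omega⟩) (v := ⟨1, by omega⟩)
    (by simp [SimpleGraph.pathGraph_adj])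
  rw [Ne, Fin.ext_iff] at h
  omega

theorem three_le_of_nonrepColoring_pathGraph {n m : ℕ} (hn : 4 ≤ n) (c : Fin n → Fin m)
    (hc : NonrepColoring (SimpleGraph.pathGraph n) c) : 3 ≤ m := by
  by_contra! hm
  have a₀ : (SimpleGraph.pathGraph n).Adj ⟨0, by omega⟩ ⟨1, by omega⟩ := by
    simp [SimpleGraph.pathGraph_adj]
  have a₁ : (SimpleGraph.pathGraph n).Adj ⟨1, by omega⟩ ⟨2, by omega⟩ := by
    simp [SimpleGraph.pathGraph_adj]
  have a₂ : (SimpleGraph.pathGraph n).Adj ⟨2, by omega⟩ ⟨3, by omega⟩ := by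
    simp [SimpleGraph.pathGraph_adj]
  have h₀ := hc.ne_of_adj a₀
  have h₁ := hc.ne_of_adj a₁
  have h₂ := hc.ne_of_adj a₂
  rw [Ne, Fin.ext_iff] at h₀ h₁ h₂
  have e₀ : c ⟨0, by omega⟩ = c ⟨2, by omega⟩ := Fin.ext (by omega)
  have e₁ : c ⟨1, by omega⟩ = c ⟨3, by omega⟩ := Fin.ext (by omega)
  refine hc _ _ (.cons a₀ (.cons a₁ (.cons a₂ .nil))) (by simp)
    ⟨[c ⟨0, by omega⟩, c ⟨1, by omega⟩], by simp, by simp [e₀, e₁]⟩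

theorem exists_nonrepColoring_pathGraph_fin_two {n : ℕ} (hn : n ≤ 3) :
    ∃ c : Fin n → Fin 2, NonrepColoring (SimpleGraph.pathGraph n) c := by
  refine ⟨_, nonrepColoring_pathGraph n (fun k => Fin.ofNat 2 k) fun i t ht hit =>
    ⟨0, ht, fun h => ?_⟩⟩
  have := congrArg Fin.val h
  simp only [Fin.ofNat] at this
  omega

/-- **Thue.** The Thue chromatic number of the path `Pₙ` on `n` vertices satisfies
`π(P₁) = 1`, `π(P₂) = π(P₃) = 2`, and `π(Pₙ) = 3` for every `n ≥ 4`. -/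
theorem thueNumber_pathGraph :
    thueNumber (SimpleGraph.pathGraph 1) = 1 ∧
    thueNumber (SimpleGraph.pathGraph 2) = 2 ∧
    thueNumber (SimpleGraph.pathGraph 3) = 2 ∧
    ∀ n : ℕ, 4 ≤ n → thueNumber (SimpleGraph.pathGraph n) = 3 := by
  refine ⟨thueNumber_eq ?_ fun m c _ => (c 0).pos,
    thueNumber_eq (exists_nonrepColoring_pathGraph_fin_two (by norm_num))
      fun m c => two_le_of_nonrepColoring_pathGraph (by norm_num) c,
    thueNumber_eq (exists_nonrepColoring_pathGraph_fin_two (by norm_num))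
      fun m c => two_le_of_nonrepColoring_pathGraph (by norm_num) c,
    fun n hn => thueNumber_eq ?_ fun m c => three_le_of_nonrepColoring_pathGraph hn c⟩
  · exact ⟨_, nonrepColoring_pathGraph 1 (fun _ => (0 : Fin 1)) fun i t ht hit => by omega⟩
  · exact ⟨_, nonrepColoring_pathGraph n ternaryThue fun i t ht _ =>
      ternaryThue_squareFree i t ht⟩
end
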